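/- arXiv:2006.03954 — 2 statements merged into one kernel-verified Lean document; each statement's English description precedes it below -/
import Mathlib

section
/- For every positive natural number d, the ℂ-subalgebra of the d×d complex matrix algebra generated by the shift matrix X and the clock matrix Z is the whole matrix algebra M_d(ℂ); that is, a pair of parafermions of order d generates the full d×d matrix algebra. -/
open Complex

/-- The shift (parafermion) matrix `X` of order `d`: `X j k = 1` iff `j = k + 1`. -/
def shiftMatrix (d : ℕ) : Matrix (ZMod d) (ZMod d) ℂ :=
  fun j k => if j = k + 1 then 1 else 0

/-- The clock matrix `Z` of order `d`: diagonal with entries `q ^ k`, `q = exp(2πi/d)`. -/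
noncomputable def clockMatrix (d : ℕ) : Matrix (ZMod d) (ZMod d) ℂ :=
  fun j k => if j = k then Complex.exp (2 * Real.pi * I / d) ^ (k.val : ℕ) else 0

open Polynomial in
/-- A diagonal matrix with distinct entries generates every diagonal matrix over a field. -/
theorem diagonal_mem_adjoin_diagonal {n K : Type*} [Fintype n] [DecidableEq n] [Field K]
    {v : n → K} (hv : Function.Injective v) (w : n → K) :
    Matrix.diagonal w ∈ Algebra.adjoin K {Matrix.diagonal v} := by
  have h : aeval (Matrix.diagonal v) (Lagrange.interpolate Finset.univ v w) =
      Matrix.diagonal w := by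
    have h1 := aeval_algHom_apply (Matrix.diagonalAlgHom (n := n) (α := K) K) v
      (Lagrange.interpolate Finset.univ v w)
    rw [Matrix.diagonalAlgHom_apply, Matrix.diagonalAlgHom_apply] at h1
    rw [h1]
    congr 1
    ext i
    have h2 := aeval_algHom_apply (Pi.evalAlgHom K (fun _ : n => K) i) v
      (Lagrange.interpolate Finset.univ v w)
    simp only [Pi.evalAlgHom_apply, coe_aeval_eq_eval] at h2
    rw [← h2]
    exact Lagrange.eval_interpolate_at_node w hv.injOn (Finset.mem_univ i)
  exact h ▸ aeval_mem_adjoin_singleton K _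

theorem clockMatrix_eq_diagonal (d : ℕ) [NeZero d] :
    clockMatrix d = Matrix.diagonal fun k => Complex.exp (2 * Real.pi * I / d) ^ k.val := by
  ext j k
  by_cases h : j = k
  · simp [clockMatrix, h]
  · simp [clockMatrix, h]

theorem injective_exp_pow_val (d : ℕ) [NeZero d] :
    Function.Injective fun k : ZMod d => Complex.exp (2 * Real.pi * I / d) ^ k.val := fun j k h =>
  ZMod.val_injective d <|
    (Complex.isPrimitiveRoot_exp d (NeZero.ne d)).pow_inj (ZMod.val_lt j) (ZMod.val_lt k) h

theorem shiftMatrix_mul_single (d : ℕ) [NeZero d] (i j : ZMod d) :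
    shiftMatrix d * Matrix.single i j 1 = Matrix.single (i + 1) j 1 := by
  ext a b
  by_cases hb : b = j
  · subst hb
    simp [shiftMatrix, Matrix.single_apply, eq_comm]
  · simp [Matrix.mul_apply, Ne.symm hb]

theorem shiftMatrix_pow_mul_single (d : ℕ) [NeZero d] (n : ℕ) (i j : ZMod d) :
    shiftMatrix d ^ n * Matrix.single i j 1 = Matrix.single (i + n) j 1 := by
  induction n with
  | zero => simp
  | succ n ih =>
    rw [pow_succ', mul_assoc, ih, shiftMatrix_mul_single, Nat.cast_succ, add_assoc]

/-- A pair of parafermions of order `d` (the clock and shift matrices) generates the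
full `d × d` matrix algebra `M_d(ℂ)`. -/
theorem clock_shift_generate_matrix_algebra (d : ℕ) (hd : 0 < d) :
    haveI : NeZero d := ⟨hd.ne'⟩
    Algebra.adjoin ℂ ({shiftMatrix d, clockMatrix d} : Set (Matrix (ZMod d) (ZMod d) ℂ)) = ⊤ := by
  have : NeZero d := ⟨hd.ne'⟩
  let A := Algebra.adjoin ℂ ({shiftMatrix d, clockMatrix d} : Set (Matrix (ZMod d) (ZMod d) ℂ))
  have hX : shiftMatrix d ∈ A := Algebra.subset_adjoin (by simp)
  have hdiag (k : ZMod d) : Matrix.single k k (1 : ℂ) ∈ A := by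
    rw [← Matrix.diagonal_single]
    refine Algebra.adjoin_mono ?_ (diagonal_mem_adjoin_diagonal (injective_exp_pow_val d) _)
    rw [← clockMatrix_eq_diagonal]
    simp
  have hsingle (j k : ZMod d) : Matrix.single j k (1 : ℂ) ∈ A := by
    have h := A.mul_mem (A.pow_mem hX (j - k).val) (hdiag k)
    rwa [shiftMatrix_pow_mul_single, ZMod.natCast_zmod_val, add_sub_cancel] at h
  refine eq_top_iff.2 fun M _ => ?_
  rw [Matrix.matrix_eq_sum_single M]
  refine A.sum_mem fun j _ => A.sum_mem fun k _ => ?_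
  simpa [Matrix.smul_single] using A.smul_mem (hsingle j k) (M j k)
end

section
/- Let n be a positive natural number and let P, Q be complex matrices indexed by (Fin n × Fin n). If P and Q are positive semidefinite, then their box convolution P□Q, defined by (P□Q)((i,k),(j,l)) = Σ_{m,m'} P((i,m),(j,m')) · Q((m,k),(m',l)), is positive semidefinite. (This is the quantum Schur product theorem: the convolution of positive two-boxes is positive, instantiated in the tensor model.) -/
open Complex ComplexOrder

/-- The box convolution (convolution of two-boxes) of matrices indexed by pairs:
`(P □ Q)((i,k),(j,l)) = Σ_{m,m'} P((i,m),(j,m')) · Q((m,k),(m',l))`. -/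
noncomputable def boxConv {n : ℕ}
    (P Q : Matrix (Fin n × Fin n) (Fin n × Fin n) ℂ) :
    Matrix (Fin n × Fin n) (Fin n × Fin n) ℂ :=
  fun p q => ∑ m, ∑ m', P (p.1, m) (q.1, m') * Q (m, p.2) (m', q.2)

/-- Summing all blocks of a positive semidefinite block matrix gives a positive semidefinite
matrix. -/
theorem Matrix.PosSemidef.sum_blocks {ι κ : Type*} [Fintype ι] [Fintype κ]
    {K : Matrix (ι × κ) (ι × κ) ℂ} (hK : K.PosSemidef) :
    (Matrix.of fun p q => ∑ m, ∑ m', K (m, p) (m', q)).PosSemidef := by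
  classical
  convert hK.conjTranspose_mul_mul_same (Matrix.of fun (a : ι × κ) (q : κ) =>
    if a.2 = q then (1 : ℂ) else 0) using 1
  ext p q
  simp only [Matrix.mul_apply, Matrix.conjTranspose_apply, Matrix.of_apply,
    Fintype.sum_prod_type, apply_ite star, star_one, star_zero, ite_mul, one_mul, zero_mul,
    mul_ite, mul_one, mul_zero, Finset.sum_ite_eq', Finset.mem_univ, if_true]
  exact Finset.sum_comm

/-- Quantum Schur product theorem (tensor model instance): the box convolution of
positive semidefinite matrices is positive semidefinite. -/
theorem boxConv_posSemidef (n : ℕ) (hn : 0 < n)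
    (P Q : Matrix (Fin n × Fin n) (Fin n × Fin n) ℂ)
    (hP : P.PosSemidef) (hQ : Q.PosSemidef) :
    (boxConv P Q).PosSemidef := by
  exact ((hP.kronecker hQ).submatrix fun a : Fin n × (Fin n × Fin n) =>
    ((a.2.1, a.1), (a.1, a.2.2))).sum_blocks
end
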